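/- Let t ∈ ℝ, 0 ≤ β ≤ 1, and let r > 0 satisfy r·β·e^r < 1. Then for every real z with 0 < |z| ≤ r, the number z/(β(e^z − 1) + (1−β)z) is positive and (z/(β(e^z − 1) + (1−β)z))^t = Σ_{n=0}^∞ (z^n/n!) · Σ_{m=0}^n C(−t,m)·β^m · Σ_{k=0}^m C(m,k)(−1)^{m−k}·S(n+k,k)/C(n+k,n), the series converging absolutely, where S(n+k,k) is the Stirling number of the second kind and for real s, C(s,m) = s(s−1)⋯(s−m+1)/m!. -/

import Mathlib

open Real Finset

/-- Generalized binomial coefficient `C(s, m) = s(s-1)⋯(s-m+1)/m!` for real `s`. -/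
noncomputable def genBinom (s : ℝ) (m : ℕ) : ℝ :=
  (∏ i ∈ Finset.range m, (s - (i : ℝ))) / (Nat.factorial m : ℝ)

/-- Stirling numbers of the second kind (as real numbers):
`S(n,m) = (1/m!) ∑_{k=0}^m C(m,k) (−1)^{m−k} k^n`. -/
noncomputable def stirling2 (n m : ℕ) : ℝ :=
  (1 / (Nat.factorial m : ℝ)) *
    ∑ k ∈ Finset.range (m + 1),
      (Nat.choose m k : ℝ) * (-1 : ℝ) ^ (m - k) * (k : ℝ) ^ n

theorem genBinom_eq_choose (s : ℝ) (m : ℕ) : genBinom s m = Ring.choose s m := by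
  rw [Ring.choose_eq_smul, Polynomial.descPochhammer_smeval_eq_ascPochhammer,
    Polynomial.ascPochhammer_smeval_cast, Polynomial.ascPochhammer_smeval_eq_eval,
    ← descPochhammer_eval_eq_ascPochhammer, descPochhammer_eval_eq_prod_range, genBinom,
    smul_eq_mul, div_eq_inv_mul]

theorem summable_abs_genBinom_mul_pow (s : ℝ) {x : ℝ} (hx0 : 0 ≤ x) (hx1 : x < 1) :
    Summable fun m : ℕ => |genBinom s m| * x ^ m := by
  lift x to NNReal using hx0
  have h := (binomialSeries ℝ s).summable_norm_mul_pow (r := x)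
    (lt_of_lt_of_le (by exact_mod_cast hx1) binomialSeries_radius_ge_one)
  simpa [binomialSeries, FormalMultilinearSeries.ofScalars_norm, genBinom_eq_choose] using h

theorem hasSum_genBinom_mul_pow (s : ℝ) {x : ℝ} (hx : |x| < 1) :
    HasSum (fun m : ℕ => genBinom s m * x ^ m) ((1 + x) ^ s) := by
  have h := (Real.one_add_rpow_hasFPowerSeriesOnBall_zero (a := s)).hasSum (y := x)
    (by simpa [enorm_eq_nnnorm, ← NNReal.coe_lt_coe] using hx)
  simpa [binomialSeries, genBinom_eq_choose, mul_comm] using h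

/-- The formal power series `(e ^ X - 1) / X`. -/
noncomputable def expQuot : PowerSeries ℝ :=
  PowerSeries.mk fun n => ((n + 1).factorial : ℝ)⁻¹

theorem X_mul_expQuot : PowerSeries.X * expQuot = PowerSeries.exp ℝ - 1 := by
  ext n
  cases n with
  | zero => simp
  | succ n => simp [PowerSeries.coeff_succ_X_mul, expQuot, PowerSeries.coeff_exp,
      PowerSeries.coeff_one]

theorem coeff_expQuot_pow (k n : ℕ) :
    PowerSeries.coeff n (expQuot ^ k) =
      (n.factorial : ℝ)⁻¹ * (stirling2 (n + k) k / (Nat.choose (n + k) n : ℝ)) := by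
  have h : PowerSeries.coeff n (expQuot ^ k) =
      PowerSeries.coeff (n + k) ((PowerSeries.exp ℝ - 1) ^ k) := by
    rw [← X_mul_expQuot, mul_pow, PowerSeries.coeff_X_pow_mul]
  have hc : ((n + k).choose n : ℝ) * n.factorial * k.factorial = (n + k).factorial := by
    rw [Nat.choose_symm_add]
    exact_mod_cast Nat.add_choose_mul_factorial_mul_factorial n k
  have hs : PowerSeries.coeff (n + k) ((PowerSeries.exp ℝ - 1) ^ k) =
      ((n + k).factorial : ℝ)⁻¹ * ∑ j ∈ range (k + 1),
        (Nat.choose k j : ℝ) * (-1 : ℝ) ^ (k - j) * (j : ℝ) ^ (n + k) := by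
    rw [sub_eq_add_neg, add_pow, map_sum, mul_sum]
    refine sum_congr rfl fun j _ => ?_
    rw [PowerSeries.exp_pow_eq_rescale_exp, mul_assoc,
      show ((-1 : PowerSeries ℝ) ^ (k - j)) * (k.choose j : PowerSeries ℝ) =
        PowerSeries.C ((-1 : ℝ) ^ (k - j) * (k.choose j : ℝ)) by simp,
      PowerSeries.coeff_mul_C, PowerSeries.coeff_rescale, PowerSeries.coeff_exp]
    simp
    ring
  have hC : ((n + k).choose n : ℝ) ≠ 0 := by
    exact_mod_cast (Nat.choose_pos (Nat.le_add_right n k)).ne'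
  have hn : (n.factorial : ℝ) ≠ 0 := by exact_mod_cast n.factorial_ne_zero
  have hk : (k.factorial : ℝ) ≠ 0 := by exact_mod_cast k.factorial_ne_zero
  rw [h, hs, stirling2, ← hc]
  field_simp

theorem coeff_expQuot_sub_one_pow (m n : ℕ) :
    PowerSeries.coeff n ((expQuot - 1) ^ m) =
      (n.factorial : ℝ)⁻¹ * ∑ k ∈ range (m + 1), (Nat.choose m k : ℝ) * (-1 : ℝ) ^ (m - k) *
        (stirling2 (n + k) k / (Nat.choose (n + k) n : ℝ)) := by
  rw [sub_eq_add_neg, add_pow, map_sum, mul_sum]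
  refine sum_congr rfl fun k _ => ?_
  rw [mul_assoc, show ((-1 : PowerSeries ℝ) ^ (m - k)) * (m.choose k : PowerSeries ℝ) =
        PowerSeries.C ((-1 : ℝ) ^ (m - k) * (m.choose k : ℝ)) by simp,
    PowerSeries.coeff_mul_C, coeff_expQuot_pow]
  ring

theorem coeff_expQuot_sub_one_pow_nonneg (m n : ℕ) :
    0 ≤ PowerSeries.coeff n ((expQuot - 1) ^ m) := by
  induction m generalizing n with
  | zero =>
    rw [pow_zero, PowerSeries.coeff_one]
    split_ifs <;> norm_num
  | succ m ih =>
    rw [pow_succ, PowerSeries.coeff_mul]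
    refine sum_nonneg fun p _ => mul_nonneg (ih _) ?_
    rcases p with ⟨_, _ | j⟩
    · simp [expQuot]
    · simp only [expQuot, map_sub, PowerSeries.coeff_mk, PowerSeries.coeff_one]
      simp

theorem coeff_expQuot_sub_one_pow_of_lt {m n : ℕ} (h : n < m) :
    PowerSeries.coeff n ((expQuot - 1) ^ m) = 0 := by
  have hX : PowerSeries.X ∣ expQuot - 1 := by
    rw [PowerSeries.X_dvd_iff, ← PowerSeries.coeff_zero_eq_constantCoeff_apply, map_sub, expQuot,
      PowerSeries.coeff_mk, PowerSeries.coeff_zero_one]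
    simp
  exact PowerSeries.X_pow_dvd_iff.1 (pow_dvd_pow_of_dvd hX m) n h

theorem hasSum_expQuot_sub_one {x : ℝ} (hx : x ≠ 0) :
    HasSum (fun n => PowerSeries.coeff n (expQuot - 1) * x ^ n) ((Real.exp x - 1) / x - 1) := by
  have h1 : HasSum (fun n : ℕ => x ^ (n + 1) / ((n + 1).factorial : ℝ)) (Real.exp x - 1) := by
    have h := NormedSpace.expSeries_div_hasSum_exp x
    rw [← Real.exp_eq_exp_ℝ] at h
    rw [← hasSum_nat_add_iff' 1] at h
    simpa using h
  have h2 : HasSum (fun n => PowerSeries.coeff n (1 : PowerSeries ℝ) * x ^ n) 1 := by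
    convert! hasSum_ite_eq (0 : ℕ) (1 : ℝ) using 2 with n
    rw [PowerSeries.coeff_one]
    split_ifs with hn <;> simp [hn]
  convert! (h1.div_const x).sub h2 using 2 with n
  rw [map_sub, sub_mul, expQuot, PowerSeries.coeff_mk, pow_succ]
  field_simp

theorem hasSum_coeff_mul_pow {P Q : PowerSeries ℝ} {x a b : ℝ}
    (hP : HasSum (fun n => PowerSeries.coeff n P * x ^ n) a)
    (hQ : HasSum (fun n => PowerSeries.coeff n Q * x ^ n) b) :
    HasSum (fun n => PowerSeries.coeff n (P * Q) * x ^ n) (a * b) := by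
  have e : (fun n => PowerSeries.coeff n (P * Q) * x ^ n) = fun n =>
      ∑ p ∈ antidiagonal n, (PowerSeries.coeff p.1 P * x ^ p.1) *
        (PowerSeries.coeff p.2 Q * x ^ p.2) := by
    funext n
    rw [PowerSeries.coeff_mul, sum_mul]
    refine sum_congr rfl fun p hp => ?_
    rw [← mem_antidiagonal.1 hp, pow_add]
    ring
  have hP' := hP.summable.norm
  have hQ' := hQ.summable.norm
  rw [e, ← hP.tsum_eq, ← hQ.tsum_eq,
    tsum_mul_tsum_eq_tsum_sum_antidiagonal_of_summable_norm hP' hQ']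
  exact (summable_norm_sum_mul_antidiagonal_of_summable_norm hP' hQ').of_norm.hasSum

theorem hasSum_expQuot_sub_one_pow {x : ℝ} (hx : x ≠ 0) (m : ℕ) :
    HasSum (fun n => PowerSeries.coeff n ((expQuot - 1) ^ m) * x ^ n)
      (((Real.exp x - 1) / x - 1) ^ m) := by
  induction m with
  | zero =>
    simp only [pow_zero]
    convert! hasSum_ite_eq (0 : ℕ) (1 : ℝ) using 2 with n
    rw [PowerSeries.coeff_one]
    split_ifs with hn <;> simp [hn]
  | succ m ih =>
    simp only [pow_succ (_ : PowerSeries ℝ), pow_succ ((Real.exp x - 1) / x - 1)]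
    exact hasSum_coeff_mul_pow ih (hasSum_expQuot_sub_one hx)

theorem abs_expQuot_sub_one_le {x : ℝ} (hx : x ≠ 0) :
    |(Real.exp x - 1) / x - 1| ≤ (Real.exp |x| - 1) / |x| - 1 := by
  rw [← (hasSum_expQuot_sub_one hx).tsum_eq, ← Real.norm_eq_abs]
  refine tsum_of_norm_bounded (hasSum_expQuot_sub_one (abs_ne_zero.2 hx)) fun n => ?_
  have h := coeff_expQuot_sub_one_pow_nonneg 1 n
  rw [pow_one] at h
  rw [norm_mul, norm_pow, Real.norm_of_nonneg h, Real.norm_eq_abs]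

theorem expQuot_sub_one_le {x : ℝ} (hx : 0 < x) :
    (Real.exp x - 1) / x - 1 ≤ x * Real.exp x := by
  have h1 : Real.exp x * Real.exp (-x) = 1 := by rw [← Real.exp_add]; simp
  have h2 : Real.exp x - 1 ≤ x * Real.exp x := by
    nlinarith [Real.add_one_le_exp (-x), Real.exp_pos x]
  rw [sub_le_iff_le_add, div_le_iff₀ hx]
  nlinarith [mul_le_mul_of_nonneg_left h2 hx.le]

theorem stmt_17 (t β : ℝ) (hβ0 : 0 ≤ β) (hβ1 : β ≤ 1)
    (r : ℝ) (hr : 0 < r) (hcond : r * β * Real.exp r < 1)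
    (z : ℝ) (hz0 : 0 < |z|) (hz : |z| ≤ r) :
    0 < z / (β * (Real.exp z - 1) + (1 - β) * z) ∧
    Summable (fun n : ℕ => |z ^ n / (Nat.factorial n : ℝ) *
      ∑ m ∈ Finset.range (n + 1), genBinom (-t) m * β ^ m *
        ∑ k ∈ Finset.range (m + 1), (Nat.choose m k : ℝ) * (-1 : ℝ) ^ (m - k) *
          (stirling2 (n + k) k / (Nat.choose (n + k) n : ℝ))|) ∧
    (z / (β * (Real.exp z - 1) + (1 - β) * z)) ^ t =
      ∑' n : ℕ, z ^ n / (Nat.factorial n : ℝ) *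
        ∑ m ∈ Finset.range (n + 1), genBinom (-t) m * β ^ m *
          ∑ k ∈ Finset.range (m + 1), (Nat.choose m k : ℝ) * (-1 : ℝ) ^ (m - k) *
            (stirling2 (n + k) k / (Nat.choose (n + k) n : ℝ)) := by
  have hz' : z ≠ 0 := abs_pos.1 hz0
  set g : ℝ := (Real.exp z - 1) / z - 1 with hg
  set G : ℝ := (Real.exp |z| - 1) / |z| - 1 with hG
  have hgG : |g| ≤ G := abs_expQuot_sub_one_le hz'
  have hG0 : 0 ≤ G := (abs_nonneg g).trans hgG
  have hG1 : β * G < 1 := by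
    have h : |z| * Real.exp |z| ≤ r * Real.exp r := by gcongr
    have h' := mul_le_mul_of_nonneg_left ((expQuot_sub_one_le hz0).trans h) hβ0
    linarith
  have hβg : |β * g| < 1 := by
    rw [abs_mul, abs_of_nonneg hβ0]
    exact (mul_le_mul_of_nonneg_left hgG hβ0).trans_lt hG1
  have hpos : 0 < 1 + β * g := by linarith [(abs_lt.1 hβg).1]
  have hq : z / (β * (Real.exp z - 1) + (1 - β) * z) = (1 + β * g)⁻¹ := by
    rw [show β * (Real.exp z - 1) + (1 - β) * z = z * (1 + β * g) by rw [hg]; field_simp; ring]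
    rw [div_mul_eq_div_div, div_self hz', one_div]
  set F : ℕ × ℕ → ℝ := fun p => genBinom (-t) p.1 * β ^ p.1 *
    (PowerSeries.coeff p.2 ((expQuot - 1) ^ p.1) * z ^ p.2) with hF
  have habs (m n : ℕ) : ‖F (m, n)‖ = |genBinom (-t) m| * β ^ m *
      (PowerSeries.coeff n ((expQuot - 1) ^ m) * |z| ^ n) := by
    simp only [hF, Real.norm_eq_abs, abs_mul, abs_pow, abs_of_nonneg hβ0,
      abs_of_nonneg (coeff_expQuot_sub_one_pow_nonneg m n)]
  have hrow (m : ℕ) : HasSum (fun n => ‖F (m, n)‖) (|genBinom (-t) m| * (β * G) ^ m) := by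
    simp only [habs, mul_pow, ← mul_assoc (|genBinom (-t) m|)]
    simpa only [mul_assoc] using
      (hasSum_expQuot_sub_one_pow hz0.ne' m).mul_left (|genBinom (-t) m| * β ^ m)
  have hnorm : Summable fun p => ‖F p‖ := by
    refine (summable_prod_of_nonneg fun p => norm_nonneg _).2
      ⟨fun m => (hrow m).summable, ?_⟩
    simp only [(hrow _).tsum_eq]
    exact summable_abs_genBinom_mul_pow (-t) (mul_nonneg hβ0 hG0) hG1
  have hFsum : HasSum F ((1 + β * g) ^ (-t)) := by
    have h := hnorm.of_norm.hasSum
    have hm (m : ℕ) : HasSum (fun n => F (m, n)) (genBinom (-t) m * (β * g) ^ m) := by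
      rw [mul_pow, ← mul_assoc]
      exact (hasSum_expQuot_sub_one_pow hz' m).mul_left _
    rwa [(h.prod_fiberwise hm).unique (hasSum_genBinom_mul_pow (-t) hβg)] at h
  have hcol (n : ℕ) : HasSum (fun m => F (m, n)) (z ^ n / (n.factorial : ℝ) *
      ∑ m ∈ range (n + 1), genBinom (-t) m * β ^ m *
        ∑ k ∈ range (m + 1), (Nat.choose m k : ℝ) * (-1 : ℝ) ^ (m - k) *
          (stirling2 (n + k) k / (Nat.choose (n + k) n : ℝ))) := by
    rw [mul_sum]
    have h : HasSum (fun m => F (m, n)) (∑ m ∈ range (n + 1), F (m, n)) := by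
      refine hasSum_sum_of_ne_finset_zero fun m hm => ?_
      simp only [hF]
      rw [coeff_expQuot_sub_one_pow_of_lt (by simpa using hm)]
      simp
    convert! h using 1
    refine sum_congr rfl fun m _ => ?_
    simp only [hF, coeff_expQuot_sub_one_pow]
    ring
  have hswap : HasSum (F ∘ Prod.swap) ((1 + β * g) ^ (-t)) :=
    (Equiv.prodComm ℕ ℕ).hasSum_iff.2 hFsum
  have hmain := hswap.prod_fiberwise hcol
  rw [hq]
  refine ⟨inv_pos.2 hpos, hmain.summable.abs, ?_⟩
  rw [hmain.tsum_eq, Real.inv_rpow hpos.le, Real.rpow_neg hpos.le]
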